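/- Let ψ : ℝ^n → R_k be any function such that for every u ∈ ℝ^n, ψ(u) is a top-k subset of u, i.e. Σ_{i∈ψ(u)} u_i = σ_k(u) (the argmax link). Then (L_k, ψ) is calibrated with respect to the top-k loss ℓ_k: for every p in the simplex Δ, there exists ε > 0 such that every u ∈ ℝ^n with ψ(u) ∉ γ_k(p) satisfies Σ_{y∈Y} p_y L_k(u,y) ≥ ε + inf_{u'∈ℝ^n} Σ_{y∈Y} p_y L_k(u',y). -/

import Mathlib

open scoped NNReal

def simplex (n : ℕ) : Set (Fin n → ℝ) := {p | (∀ i, 0 ≤ p i) ∧ ∑ i, p i = 1}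

noncomputable def sigmaTop (n m : ℕ) (u : Fin n → ℝ) : ℝ :=
  if h : ((Finset.univ : Finset (Fin n)).powersetCard m).Nonempty then
    ((Finset.univ : Finset (Fin n)).powersetCard m).sup' h (fun S => ∑ i ∈ S, u i)
  else 0

noncomputable def Lk (n k : ℕ) (u : Fin n → ℝ) (y : Fin n) : ℝ :=
  if h : (Finset.Icc 1 n).Nonempty then
    (Finset.Icc 1 n).sup' h
      (fun m => sigmaTop n m u / (m : ℝ) + max 0 (1 - (k : ℝ) / (m : ℝ))) - u y
  else 0

def indic {n : ℕ} (S : Finset (Fin n)) : Fin n → ℝ := fun i => if i ∈ S then 1 else 0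

noncomputable def nthLarge {n : ℕ} (v : Fin n → ℝ) (j : ℕ) : ℝ :=
  if h : n - j < n then v (Tuple.sort v ⟨n - j, h⟩) else 0

noncomputable def L2 (n k : ℕ) (u : Fin n → ℝ) (y : Fin n) : ℝ :=
  max 0 (1 - u y + (1 / (k : ℝ)) * sigmaTop n k (u - Pi.single y 1))

noncomputable def L3 (n k : ℕ) (u : Fin n → ℝ) (y : Fin n) : ℝ :=
  (1 / (k : ℝ)) * ∑ i ∈ Finset.Icc 1 k, max 0 (1 - u y + nthLarge (u - Pi.single y 1) i)

noncomputable def sigmaExcl (n k : ℕ) (u : Fin n → ℝ) (y : Fin n) : ℝ :=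
  if h : ((Finset.univ.erase y).powersetCard k).Nonempty then
    ((Finset.univ.erase y).powersetCard k).sup' h (fun S => ∑ i ∈ S, u i)
  else 0

noncomputable def L4 (n k : ℕ) (u : Fin n → ℝ) (y : Fin n) : ℝ :=
  max 0 (1 - u y + (1 / (k : ℝ)) * sigmaExcl n k u y)

noncomputable def ell2 (k : ℕ) {n : ℕ} (H M : Finset (Fin n)) (y : Fin n) : ℝ :=
  if y ∈ H then 0
  else if y ∈ M then ((H.card : ℝ) + M.card - 1) / ((k : ℝ) - H.card)
  else ((H.card : ℝ) + M.card - 1) / ((k : ℝ) - H.card) + ((k : ℝ) + 1) / k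

noncomputable def ell4 (k : ℕ) {n : ℕ} (T : Finset (Fin n)) (y : Fin n) : ℝ :=
  if y ∈ T then 0 else ((k : ℝ) + 1) / ((k : ℝ) + 1 - T.card)

section TopKCalibration

open Finset Filter Topology

variable {n : ℕ}

/-- The affine piece of the top-`k` surrogate indexed by the set `Q`. -/
noncomputable def piece (k : ℕ) (Q : Finset (Fin n)) (u : Fin n → ℝ) : ℝ :=
  (∑ i ∈ Q, u i) / (Q.card : ℝ) + max 0 (1 - (k : ℝ) / (Q.card : ℝ))

/-- The label-independent part of the top-`k` surrogate, as a maximum of its affine pieces. -/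
noncomputable def envelope [NeZero n] (k : ℕ) (u : Fin n → ℝ) : ℝ :=
  (univ.filter (Finset.Nonempty : Finset (Fin n) → Prop)).sup'
    (Finset.filter_nonempty_iff.2 ⟨univ, Finset.mem_univ _, Finset.univ_nonempty⟩) (fun Q => piece k Q u)

lemma piece_le_envelope [NeZero n] (k : ℕ) (u : Fin n → ℝ) {Q : Finset (Fin n)}
    (hQ : Q.Nonempty) : piece k Q u ≤ envelope k u :=
  Finset.le_sup' (fun Q => piece k Q u) (by simpa using hQ)

lemma envelope_le_iff [NeZero n] (k : ℕ) (u : Fin n → ℝ) (c : ℝ) :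
    envelope k u ≤ c ↔ ∀ Q : Finset (Fin n), Q.Nonempty → piece k Q u ≤ c := by
  refine (Finset.sup'_le_iff _ _).trans ?_
  simp

lemma continuous_piece (k : ℕ) (Q : Finset (Fin n)) : Continuous (piece k Q) := by
  unfold piece
  fun_prop

lemma continuous_envelope [NeZero n] (k : ℕ) :
    Continuous (envelope k : (Fin n → ℝ) → ℝ) :=
  Continuous.finset_sup'_apply _ fun Q _ => continuous_piece k Q

lemma sum_le_sigmaTop (u : Fin n → ℝ) (Q : Finset (Fin n)) :
    ∑ i ∈ Q, u i ≤ sigmaTop n Q.card u := by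
  have hQ : Q ∈ (univ : Finset (Fin n)).powersetCard Q.card := by simp
  rw [sigmaTop, dif_pos ⟨Q, hQ⟩]
  exact Finset.le_sup' (fun S => ∑ i ∈ S, u i) hQ

lemma exists_sum_eq_sigmaTop (u : Fin n → ℝ) {m : ℕ} (hm : m ≤ n) :
    ∃ Q : Finset (Fin n), Q.card = m ∧ ∑ i ∈ Q, u i = sigmaTop n m u := by
  have h : ((univ : Finset (Fin n)).powersetCard m).Nonempty := by
    simpa [Finset.powersetCard_nonempty] using hm
  obtain ⟨Q, hQ, h'⟩ := Finset.exists_mem_eq_sup' h (fun S => ∑ i ∈ S, u i)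
  refine ⟨Q, (Finset.mem_powersetCard.1 hQ).2, ?_⟩
  rw [sigmaTop, dif_pos h, h']

lemma Lk_eq [NeZero n] (k : ℕ) (u : Fin n → ℝ) (y : Fin n) :
    Lk n k u y = envelope k u - u y := by
  have h : (Finset.Icc 1 n).Nonempty := by
    simpa using Nat.one_le_iff_ne_zero.2 (NeZero.ne n)
  rw [Lk, dif_pos h]
  congr 1
  apply le_antisymm
  · refine Finset.sup'_le _ _ fun m hm => ?_
    rw [Finset.mem_Icc] at hm
    obtain ⟨Q, rfl, hQ⟩ := exists_sum_eq_sigmaTop u hm.2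
    rw [← hQ]
    exact piece_le_envelope k u (Finset.card_pos.1 hm.1)
  · rw [envelope_le_iff]
    intro Q hQ
    have hm : Q.card ∈ Finset.Icc 1 n := by
      rw [Finset.mem_Icc]
      exact ⟨Finset.card_pos.2 hQ, by simpa using Finset.card_le_univ Q⟩
    refine le_trans ?_ (Finset.le_sup' _ hm)
    unfold piece
    gcongr
    exact sum_le_sigmaTop u Q

lemma sum_mul_Lk [NeZero n] (k : ℕ) {p : Fin n → ℝ} (hp : p ∈ simplex n) (u : Fin n → ℝ) :
    ∑ y, p y * Lk n k u y = envelope k u - ∑ y, p y * u y := by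
  simp only [Lk_eq, mul_sub, Finset.sum_sub_distrib, ← Finset.sum_mul, hp.2, one_mul]

lemma le_envelope [NeZero n] (k : ℕ) (u : Fin n → ℝ) (y : Fin n) : u y ≤ envelope k u := by
  refine le_trans ?_ (piece_le_envelope k u (Finset.singleton_nonempty y))
  simp [piece]

lemma risk_nonneg [NeZero n] (k : ℕ) {p : Fin n → ℝ} (hp : p ∈ simplex n) (u : Fin n → ℝ) :
    0 ≤ envelope k u - ∑ y, p y * u y := by
  have h : ∑ y, p y * u y ≤ ∑ y, p y * envelope k u :=
    Finset.sum_le_sum fun y _ => mul_le_mul_of_nonneg_left (le_envelope k u y) (hp.1 y)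
  rw [← Finset.sum_mul, hp.2] at h
  linarith

/-- The entries of `u` on `T` dominate those off `T`. -/
def Dominates (T : Finset (Fin n)) (u : Fin n → ℝ) : Prop :=
  ∀ i ∈ T, ∀ j ∉ T, u j ≤ u i

lemma isClosed_dominates (T : Finset (Fin n)) :
    IsClosed {v : Fin n → ℝ | Dominates T v} := by
  simp only [Dominates, Set.ofPred_forall]
  exact isClosed_iInter fun i => isClosed_iInter fun _ => isClosed_iInter fun j =>
    isClosed_iInter fun _ => isClosed_le (by fun_prop) (by fun_prop)

lemma sum_sub_le_sum_sub {T : Finset (Fin n)} {u : Fin n → ℝ} {t : ℝ}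
    (hT : ∀ i ∈ T, t ≤ u i) (hT' : ∀ i ∉ T, u i ≤ t) (Q : Finset (Fin n)) :
    ∑ i ∈ Q, (u i - t) ≤ ∑ i ∈ T, (u i - t) := by
  rw [← Finset.sum_filter_add_sum_filter_not Q (· ∈ T)]
  have h1 : ∑ i ∈ Q with i ∉ T, (u i - t) ≤ 0 :=
    Finset.sum_nonpos fun i hi => by
      have := hT' i (Finset.mem_filter.1 hi).2
      linarith
  have h2 : ∑ i ∈ Q with i ∈ T, (u i - t) ≤ ∑ i ∈ T, (u i - t) :=
    Finset.sum_le_sum_of_subset_of_nonneg (fun i hi => (Finset.mem_filter.1 hi).2)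
      fun i hi _ => by
        have := hT i hi
        linarith
  linarith

lemma dominates_of_sum_eq {T : Finset (Fin n)} {u : Fin n → ℝ}
    (h : ∑ i ∈ T, u i = sigmaTop n T.card u) : Dominates T u := by
  intro i hi j hj
  have h1 := sum_le_sigmaTop u (insert j (T.erase i))
  have hj' : j ∉ T.erase i := fun h' => hj (Finset.mem_of_mem_erase h')
  rw [Finset.card_insert_of_notMem hj', Finset.card_erase_add_one hi, ← h,
    Finset.sum_insert hj', ← Finset.add_sum_erase T u hi] at h1
  linarith

lemma Dominates.sum_eq {T : Finset (Fin n)} {u : Fin n → ℝ} (hT : T.Nonempty)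
    (h : Dominates T u) : ∑ i ∈ T, u i = sigmaTop n T.card u := by
  apply le_antisymm (sum_le_sigmaTop u T)
  obtain ⟨Q, hQ, hs⟩ := exists_sum_eq_sigmaTop u
    (show T.card ≤ n by simpa using Finset.card_le_univ T)
  rw [← hs]
  obtain ⟨i, hi, hmin⟩ := Finset.exists_min_image T u hT
  have := sum_sub_le_sum_sub (t := u i) hmin (fun j hj => h i hi j hj) Q
  simp only [Finset.sum_sub_distrib, Finset.sum_const, hQ] at this
  linarith

lemma piece_eq_add {k : ℕ} {Q : Finset (Fin n)} (hQ : Q.Nonempty) (u : Fin n → ℝ) (t : ℝ) :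
    piece k Q u = t + ((∑ i ∈ Q, (u i - t)) / (Q.card : ℝ) +
      max 0 (1 - (k : ℝ) / (Q.card : ℝ))) := by
  have h : (Q.card : ℝ) ≠ 0 := by exact_mod_cast hQ.card_pos.ne'
  simp only [piece, Finset.sum_sub_distrib, Finset.sum_const, nsmul_eq_mul]
  field_simp
  ring

/-- Among the pieces attaining the maximum, none separates two tied entries that are themselves
separated by a top-`k` set. -/
lemma mem_of_piece_eq_envelope [NeZero n] {T Q : Finset (Fin n)} {v : Fin n → ℝ} {i j : Fin n}
    (hv : Dominates T v) (hi : i ∈ T) (hj : j ∉ T) (hij : v i = v j) (hjQ : j ∈ Q)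
    (hQ : piece T.card Q v = envelope T.card v) : i ∈ Q := by
  by_contra hiQ
  set t := v i with ht
  set k := T.card with hk
  have hmax : ∀ R : Finset (Fin n), R.Nonempty → piece k R v ≤ piece k Q v := fun R hR =>
    hQ ▸ piece_le_envelope k v hR
  have hQne : Q.Nonempty := ⟨j, hjQ⟩
  have hDC := sum_sub_le_sum_sub (t := t) (fun x hx => hij ▸ hv x hx j hj)
    (fun x hx => hv i hi x hx) Q
  have hC0 : 0 ≤ ∑ x ∈ T, (v x - t) := Finset.sum_nonneg fun x hx => by
    have := hv x hx j hj
    linarith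
  set D := ∑ x ∈ Q, (v x - t) with hD
  set C := ∑ x ∈ T, (v x - t) with hC
  have hk1 : 1 ≤ k := Finset.card_pos.2 ⟨i, hi⟩
  have hm1 : 1 ≤ Q.card := Finset.card_pos.2 hQne
  have hk1' : (1 : ℝ) ≤ k := by exact_mod_cast hk1
  have hm1' : (1 : ℝ) ≤ Q.card := by exact_mod_cast hm1
  have eQ := piece_eq_add (k := k) hQne v t
  have hins : D / (Q.card + 1) + max 0 (1 - (k : ℝ) / (Q.card + 1)) ≤
      D / Q.card + max 0 (1 - (k : ℝ) / Q.card) := by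
    have h := hmax (insert i Q) (Finset.insert_nonempty _ _)
    rw [piece_eq_add (Finset.insert_nonempty _ _) v t, eQ, Finset.sum_insert hiQ,
      Finset.card_insert_of_notMem hiQ] at h
    rw [← ht, sub_self, zero_add, ← hD] at h
    push_cast at h
    linarith
  have hera : 2 ≤ Q.card → D / (Q.card - 1) + max 0 (1 - (k : ℝ) / (Q.card - 1)) ≤
      D / Q.card + max 0 (1 - (k : ℝ) / Q.card) := by
    intro h2
    have hne : (Q.erase j).Nonempty := by
      rw [← Finset.card_pos, Finset.card_erase_of_mem hjQ]
      omega
    have h := hmax _ hne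
    have hs := Finset.add_sum_erase Q (fun x => v x - t) hjQ
    rw [piece_eq_add hne v t, eQ, Finset.card_erase_of_mem hjQ, Nat.cast_sub hm1] at h
    have hs' : ∑ x ∈ Q.erase j, (v x - t) = D := by linarith
    rw [hs'] at h
    push_cast at h
    linarith
  have hone : Q.card = 1 → D = 0 := by
    intro h1
    obtain ⟨x, hx⟩ := Finset.card_eq_one.1 h1
    have : j = x := by simpa [hx] using hjQ
    rw [hD, hx, ← this, Finset.sum_singleton, ← hij, sub_self]
  have hbig : C / (k + 1) + (1 - (k : ℝ) / (k + 1)) ≤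
      D / Q.card + max 0 (1 - (k : ℝ) / Q.card) := by
    have h := hmax (insert j T) (Finset.insert_nonempty _ _)
    rw [piece_eq_add (Finset.insert_nonempty _ _) v t, eQ, Finset.sum_insert hj,
      Finset.card_insert_of_notMem hj, ← hij, sub_self, zero_add, ← hC, ← hk, ← hD] at h
    push_cast at h
    have := le_max_right 0 (1 - (k : ℝ) / (k + 1))
    linarith
  have hsmall : 2 ≤ k → C / (k - 1) ≤ D / Q.card + max 0 (1 - (k : ℝ) / Q.card) := by
    intro h2
    have hne : (T.erase i).Nonempty := by
      rw [← Finset.card_pos, Finset.card_erase_of_mem hi]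
      omega
    have h := hmax _ hne
    have hs := Finset.add_sum_erase T (fun x => v x - t) hi
    rw [piece_eq_add hne v t, eQ, Finset.card_erase_of_mem hi, Nat.cast_sub hk1] at h
    have hs' : ∑ x ∈ T.erase i, (v x - t) = C := by linarith
    rw [hs'] at h
    push_cast at h
    have := le_max_left 0 (1 - (k : ℝ) / (k - 1))
    linarith
  have hCone : k = 1 → C = 0 := by
    intro h1
    obtain ⟨x, hx⟩ := Finset.card_eq_one.1 (hk.symm.trans h1)
    have : i = x := by simpa [hx] using hi
    rw [hC, hx, ← this, Finset.sum_singleton, sub_self]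
  set m := Q.card with hm
  clear_value D C m k t
  have hm0 : (0 : ℝ) < m := by linarith
  have pos_of : 0 < C / (k + 1) + (1 - (k : ℝ) / (k + 1)) := by
    have : C / (k + 1) + (1 - (k : ℝ) / (k + 1)) = (C + 1) / (k + 1) := by
      field_simp
      ring
    rw [this]
    positivity
  have hzero : ∀ x : ℝ, 0 < x → x ≤ k → max 0 (1 - (k : ℝ) / x) = 0 := fun x hx hxk => by
    rw [max_eq_left]
    rw [sub_nonpos, one_le_div hx]
    exact hxk
  rcases lt_trichotomy m k with hlt | heq | hgt
  · have hlt' : (m : ℝ) + 1 ≤ k := by exact_mod_cast hlt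
    rw [hzero m hm0 (by linarith), add_zero] at hbig hins hera
    have hDpos : 0 < D := by
      have : 0 < D / m := lt_of_lt_of_le pos_of hbig
      rcases div_pos_iff.1 this with h | h
      · exact h.1
      · linarith
    have h2 : 2 ≤ m := by
      by_contra h
      have := hone (by omega)
      linarith
    have h2' : (2 : ℝ) ≤ m := by exact_mod_cast h2
    have h := hera h2
    rw [hzero _ (by linarith) (by linarith), add_zero,
      div_le_div_iff₀ (by linarith) hm0] at h
    nlinarith
  · subst heq
    rw [hzero m hm0 le_rfl, add_zero] at hbig hins hera
    have h1 : 1 ≤ D := by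
      have h := (add_le_add_right (le_max_right 0 (1 - (m : ℝ) / (m + 1))) _).trans hins
      have e : D / (m + 1) + (1 - (m : ℝ) / (m + 1)) = (D + 1) / (m + 1) := by
        field_simp
        ring
      rw [e, div_le_div_iff₀ (by linarith) hm0] at h
      nlinarith
    have h2 : 2 ≤ m := by
      by_contra h
      have := hone (by omega)
      linarith
    have h2' : (2 : ℝ) ≤ m := by exact_mod_cast h2
    have h := hera h2
    rw [hzero _ (by linarith) (by linarith), add_zero,
      div_le_div_iff₀ (by linarith) hm0] at h
    nlinarith
  · have hgt' : (k : ℝ) + 1 ≤ m := by exact_mod_cast hgt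
    have hpos : ∀ x : ℝ, k ≤ x → max 0 (1 - (k : ℝ) / x) = 1 - k / x := fun x hx => by
      rw [max_eq_right]
      rw [sub_nonneg, div_le_one (by linarith)]
      exact hx
    rw [hpos m (by linarith)] at hins hera hsmall
    rw [hpos _ (by linarith)] at hins hera
    have e : ∀ x : ℝ, 0 < x → D / x + (1 - (k : ℝ) / x) = 1 + (D - k) / x := fun x hx => by
      field_simp
      ring
    rw [e _ (by linarith), e _ hm0] at hins hera
    have hDk : k ≤ D := by
      have h : (D - k) / (m + 1) ≤ (D - k) / m := by linarith
      rw [div_le_div_iff₀ (by linarith) hm0] at h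
      nlinarith
    have hDk' : D ≤ k := by
      have h : (D - k) / (m - 1) ≤ (D - k) / m := by linarith [hera (by omega)]
      rw [div_le_div_iff₀ (by linarith) hm0] at h
      nlinarith
    have h2 : 2 ≤ k := by
      by_contra h
      have := hCone (by omega)
      linarith
    have h2' : (2 : ℝ) ≤ k := by exact_mod_cast h2
    have h := hsmall h2
    rw [e _ hm0, le_antisymm hDk' hDk, sub_self, zero_div, add_zero,
      div_le_one (by linarith)] at h
    linarith

lemma envelope_comp_perm_le [NeZero n] (k : ℕ) (v : Fin n → ℝ) (e : Equiv.Perm (Fin n)) :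
    envelope k (v ∘ e) ≤ envelope k v := by
  rw [envelope_le_iff]
  intro Q hQ
  have := piece_le_envelope k v (hQ.map (f := e.toEmbedding))
  simpa [piece] using this

/-- A score vector whose top-`k` set is not a top-`k` set of `p` is not a risk minimizer. -/
lemma exists_risk_lt [NeZero n] {T : Finset (Fin n)} {p v : Fin n → ℝ} {i j : Fin n}
    (hv : Dominates T v) (hi : i ∈ T) (hj : j ∉ T) (hp : p i < p j) :
    ∃ w : Fin n → ℝ, envelope T.card w - ∑ y, p y * w y <
      envelope T.card v - ∑ y, p y * v y := by
  have hne : i ≠ j := fun h => hj (h ▸ hi)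
  have key : ∀ d : ℝ, ∑ y, p y * (v + d • (Pi.single j 1 - Pi.single i 1) : Fin n → ℝ) y =
      ∑ y, p y * v y + d * (p j - p i) := by
    intro d
    simp only [Pi.add_apply, Pi.smul_apply, Pi.sub_apply, smul_eq_mul, mul_add,
      Finset.sum_add_distrib, mul_sub,
      Finset.sum_sub_distrib, Pi.single_apply, mul_ite, mul_one, mul_zero, Finset.sum_ite_eq',
      Finset.mem_univ, if_true]
    ring
  rcases (hv i hi j hj).eq_or_lt with heq | hlt
  · have hev : ∀ Q : Finset (Fin n), ∀ᶠ d in 𝓝[>] (0 : ℝ), Q.Nonempty →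
        piece T.card Q (v + d • (Pi.single j 1 - Pi.single i 1)) ≤ envelope T.card v := by
      intro Q
      by_cases hQ : Q.Nonempty
      swap
      · simp [hQ]
      rcases (piece_le_envelope T.card v hQ).eq_or_lt with he | hl
      · filter_upwards [self_mem_nhdsWithin] with d hd _
        rw [← he]
        unfold piece
        gcongr ?_ / _ + _
        simp only [Pi.add_apply, Pi.smul_apply, Pi.sub_apply, smul_eq_mul,
          Finset.sum_add_distrib, ← Finset.mul_sum, Finset.sum_sub_distrib]
        have hd : 0 < d := hd
        have hs : ∀ a : Fin n, ∑ x ∈ Q, (Pi.single a 1 : Fin n → ℝ) x =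
            if a ∈ Q then 1 else 0 := fun a => by
          simp [Pi.single_apply]
        have : (if j ∈ Q then (1 : ℝ) else 0) - (if i ∈ Q then 1 else 0) ≤ 0 := by
          have hmem : j ∈ Q → i ∈ Q := fun h =>
            mem_of_piece_eq_envelope hv hi hj heq.symm h he
          by_cases hjQ : j ∈ Q
          · simp [hjQ, hmem hjQ]
          · simp only [hjQ, if_false]
            split_ifs <;> norm_num
        rw [hs, hs]
        nlinarith
      · have hc : ContinuousAt (fun d : ℝ =>
            piece T.card Q (v + d • (Pi.single j 1 - Pi.single i 1))) 0 :=
          ((continuous_piece T.card Q).comp (by fun_prop)).continuousAt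
        have := hc.eventually_lt_const (u := envelope T.card v) (by simpa using hl)
        exact (this.filter_mono nhdsWithin_le_nhds).mono fun d hd _ => hd.le
    obtain ⟨d, hd, hd0⟩ := ((eventually_all.2 hev).and self_mem_nhdsWithin).exists
    refine ⟨v + d • (Pi.single j 1 - Pi.single i 1), ?_⟩
    have h := (envelope_le_iff T.card _ _).2 hd
    have : 0 < d * (p j - p i) := mul_pos hd0 (by linarith)
    have hk := key d
    linarith
  · have hw : v ∘ Equiv.swap i j =
        v + (v i - v j) • (Pi.single j 1 - Pi.single i 1) := by
      ext x
      by_cases hxi : x = i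
      · subst hxi
        simp [hne]
      · by_cases hxj : x = j
        · subst hxj
          simp [hne.symm]
        · simp [Equiv.swap_apply_of_ne_of_ne hxi hxj, hxi, hxj]
    refine ⟨v ∘ Equiv.swap i j, ?_⟩
    have h := envelope_comp_perm_le T.card v (Equiv.swap i j)
    have hk := key (v i - v j)
    rw [← hw] at hk
    have : 0 < (v i - v j) * (p j - p i) := mul_pos (by linarith) (by linarith)
    linarith

/-- Lowering all the entries above a wide enough gap lowers the envelope by the same amount. -/
lemma envelope_sub_le [NeZero n] {k : ℕ} {S : Finset (Fin n)} (hS : S.Nonempty)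
    {v w : Fin n → ℝ} {c d : ℝ} (hin : ∀ x ∈ S, w x = v x - d)
    (hw : ∀ x ∈ S, c + n ≤ w x) (hc : ∀ x ∉ S, w x ≤ c) :
    envelope k w ≤ envelope k v - d := by
  have hsub : ∀ Q : Finset (Fin n), Q.Nonempty → Q ⊆ S → piece k Q w ≤ envelope k v - d := by
    intro Q hQ hQS
    have h := piece_le_envelope k v hQ
    have e : ∑ x ∈ Q, (w x - -d) = ∑ x ∈ Q, v x :=
      Finset.sum_congr rfl fun x hx => by rw [hin x (hQS hx)]; ring
    rw [piece_eq_add hQ w (-d), e]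
    unfold piece at h
    linarith
  have hn : (0 : ℝ) ≤ n := Nat.cast_nonneg n
  rw [envelope_le_iff]
  intro Q hQ
  rcases le_or_gt Q.card S.card with hle | hgt
  · obtain ⟨R, hR1, hR2, hR3⟩ := Finset.exists_subsuperset_card_eq
      (Finset.inter_subset_right : Q ∩ S ⊆ S)
      (Finset.card_le_card Finset.inter_subset_left) hle
    have hRne : R.Nonempty := by
      rw [← Finset.card_pos, hR3]
      exact hQ.card_pos
    refine le_trans ?_ (hsub R hRne hR2)
    rw [piece_eq_add hQ w c, piece_eq_add hRne w c, hR3]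
    gcongr _ + (?_ / _ + _)
    have hnn : ∀ x ∈ R, 0 ≤ w x - c := fun x hx => by
      have := hw x (hR2 hx)
      linarith
    rw [← Finset.sum_filter_add_sum_filter_not Q (· ∈ S)]
    have h1 : ∑ x ∈ Q with x ∉ S, (w x - c) ≤ 0 := Finset.sum_nonpos fun x hx => by
      have := hc x (Finset.mem_filter.1 hx).2
      linarith
    have h2 : ∑ x ∈ Q with x ∈ S, (w x - c) ≤ ∑ x ∈ R, (w x - c) :=
      Finset.sum_le_sum_of_subset_of_nonneg
        (fun x hx => hR1 (by simpa using hx)) fun x hx _ => hnn x hx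
    linarith
  · refine le_trans ?_ (hsub S hS subset_rfl)
    rw [piece_eq_add hQ w c, piece_eq_add hS w c]
    have h1 : ∑ x ∈ Q, (w x - c) ≤ ∑ x ∈ S, (w x - c) :=
      sum_sub_le_sum_sub (fun x hx => by linarith [hw x hx]) hc Q
    have h2 : S.card * (n : ℝ) ≤ ∑ x ∈ S, (w x - c) := by
      rw [← nsmul_eq_mul]
      exact Finset.card_nsmul_le_sum _ _ _ fun x hx => by linarith [hw x hx]
    have hq : (Q.card : ℝ) ≤ n := by
      exact_mod_cast (by simpa using Finset.card_le_univ Q : Q.card ≤ n)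
    have hs0 : (0 : ℝ) < S.card := by exact_mod_cast hS.card_pos
    have hqs : (S.card : ℝ) + 1 ≤ Q.card := by exact_mod_cast hgt
    set X := ∑ x ∈ S, (w x - c)
    have hmax : max 0 (1 - (k : ℝ) / Q.card) ≤ 1 :=
      max_le zero_le_one (by linarith [show (0 : ℝ) ≤ k / Q.card by positivity])
    have hmax' := le_max_left 0 (1 - (k : ℝ) / S.card)
    have h3 : (∑ x ∈ Q, (w x - c)) / Q.card ≤ X / Q.card := by gcongr
    have h4 : X / Q.card + 1 ≤ X / S.card := by
      have hq0 : (0 : ℝ) < Q.card := by linarith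
      have e : X / Q.card + 1 = (X + Q.card) / Q.card := by field_simp
      rw [e, div_le_div_iff₀ hq0 hs0]
      have : (S.card : ℝ) * Q.card ≤ S.card * n := by gcongr
      have hX : 0 ≤ X := le_trans (by positivity) h2
      nlinarith
    linarith

/-- Some interval of a family of `n` disjoint ones avoids the values of a vector in `ℝⁿ` one of
whose entries exceeds them all. -/
lemma exists_gap {v : Fin n → ℝ} {c : ℝ} {x : Fin n} (hc : 0 < c) (hx : n * c < v x) :
    ∃ l : ℕ, l < n ∧ ∀ y, v y ≤ l * c ∨ (l + 1) * c < v y := by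
  by_contra! h
  have h' : ∀ l : Fin n, ∃ y, (l : ℕ) * c < v y ∧ v y ≤ ((l : ℕ) + 1) * c := fun l => h l l.2
  choose f hf1 hf2 using h'
  have hinj : Function.Injective f := by
    have hle : ∀ a b, f a = f b → (a : ℕ) ≤ b := by
      intro a b hab
      by_contra! hlt
      have h1 := hf1 a
      have h2 := hf2 b
      rw [hab] at h1
      have : ((b : ℕ) : ℝ) + 1 ≤ (a : ℕ) := by exact_mod_cast hlt
      nlinarith
    intro a b hab
    exact Fin.ext (le_antisymm (hle a b hab) (hle b a hab.symm))
  obtain ⟨l, hl⟩ := (Finite.surjective_of_injective hinj) x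
  have h2 := hf2 l
  rw [hl] at h2
  have : ((l : ℕ) : ℝ) + 1 ≤ n := by exact_mod_cast l.2
  nlinarith

/-- Score vectors can be moved into a fixed box without increasing the risk and without leaving
the cone of vectors dominated by their entries on `T`. -/
lemma exists_bounded_risk_le [NeZero n] (k : ℕ) {T : Finset (Fin n)} {p : Fin n → ℝ}
    (hp : p ∈ simplex n) {u : Fin n → ℝ} (hu : Dominates T u) :
    ∃ v : Fin n → ℝ, (∀ x, v x ∈ Set.Icc (0 : ℝ) (n * (2 * n))) ∧ Dominates T v ∧
      envelope k v - ∑ y, p y * v y ≤ envelope k u - ∑ y, p y * u y := by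
  have hn : (0 : ℝ) < n := by exact_mod_cast Nat.pos_of_ne_zero (NeZero.ne n)
  set E : (Fin n → ℝ) → ℝ := fun v => envelope k v - ∑ y, p y * v y with hE
  have hEc : Continuous E := (continuous_envelope k).sub (by fun_prop)
  obtain ⟨x₀, -, hx₀⟩ := Finset.exists_min_image univ u ⟨0, Finset.mem_univ _⟩
  set u₀ : Fin n → ℝ := fun x => u x - u x₀ with hu₀
  have hu₀E : E u₀ ≤ E u := by
    have h1 : envelope k u₀ ≤ envelope k u - u x₀ := by
      rw [envelope_le_iff]
      intro Q hQ
      have h2 := piece_le_envelope k u hQ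
      rw [piece_eq_add hQ u (u x₀)] at h2
      simp only [piece, hu₀]
      linarith
    have h2 : ∑ y, p y * u₀ y = ∑ y, p y * u y - u x₀ := by
      simp only [hu₀, mul_sub, Finset.sum_sub_distrib, ← Finset.sum_mul, hp.2, one_mul]
    simp only [hE]
    linarith
  set M := ∑ y, u₀ y with hM
  set K : Set (Fin n → ℝ) :=
    Set.Icc 0 (fun _ => M) ∩ ({v | Dominates T v} ∩ {v | E v ≤ E u}) with hK
  have hKc : IsCompact K :=
    isCompact_Icc.inter_right ((isClosed_dominates T).inter (isClosed_le hEc continuous_const))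
  have hu₀nn : ∀ x, 0 ≤ u₀ x := fun x => sub_nonneg.2 (hx₀ x (Finset.mem_univ _))
  have hKne : K.Nonempty := by
    refine ⟨u₀, ⟨hu₀nn, fun x => ?_⟩, fun i hi j hj => ?_, hu₀E⟩
    · exact Finset.single_le_sum (f := u₀) (fun y _ => hu₀nn y) (Finset.mem_univ x)
    · exact sub_le_sub_right (hu i hi j hj) _
  obtain ⟨v, ⟨⟨hv0, hvM⟩, hvT, hvE⟩, hmin⟩ := hKc.exists_isMinOn hKne
    (f := fun v => ∑ y, v y) (by fun_prop)
  refine ⟨v, fun x => ⟨hv0 x, ?_⟩, hvT, hvE⟩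
  by_contra! hx
  obtain ⟨l, hl, hgap⟩ := exists_gap (by positivity) hx
  set c : ℝ := l * (2 * n) with hc
  have hc0 : 0 ≤ c := by positivity
  set S : Finset (Fin n) := univ.filter fun y => c < v y with hSdef
  have hSin : ∀ y ∈ S, c + 2 * n < v y := fun y hy => by
    have hy' : c < v y := (Finset.mem_filter.1 hy).2
    rcases hgap y with h | h
    · linarith
    · linarith
  have hSout : ∀ y ∉ S, v y ≤ c := fun y hy => by
    simpa [hSdef] using hy
  have hxS : x ∈ S := by
    rw [hSdef, Finset.mem_filter]
    refine ⟨Finset.mem_univ _, lt_of_le_of_lt ?_ hx⟩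
    rw [hc]
    gcongr
  set w : Fin n → ℝ := fun y => if y ∈ S then v y - n else v y with hw
  have hwin : ∀ y ∈ S, w y = v y - n := fun y hy => if_pos hy
  have hwout : ∀ y ∉ S, w y = v y := fun y hy => if_neg hy
  have hwv : ∀ y, w y ≤ v y := fun y => by
    by_cases hy : y ∈ S
    · rw [hwin y hy]; linarith
    · rw [hwout y hy]
  have hwS : ∀ y ∈ S, c + n ≤ w y := fun y hy => by
    rw [hwin y hy]
    linarith [hSin y hy]
  have hwc : ∀ y ∉ S, w y ≤ c := fun y hy => by
    rw [hwout y hy]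
    exact hSout y hy
  have hwK : w ∈ K := by
    refine ⟨⟨fun y => ?_, fun y => (hwv y).trans (hvM y)⟩, fun i hi j hj => ?_, ?_⟩
    · by_cases hy : y ∈ S
      · have := hwS y hy
        simp only [Pi.zero_apply]
        linarith
      · rw [hwout y hy]
        exact hv0 y
    · have hij := hvT i hi j hj
      by_cases hiS : i ∈ S
      · by_cases hjS : j ∈ S
        · rw [hwin i hiS, hwin j hjS]
          linarith
        · linarith [hwS i hiS, hwc j hjS]
      · have hjS : j ∉ S := fun hjS => by
          linarith [hSin j hjS, hSout i hiS]
        rw [hwout i hiS, hwout j hjS]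
        exact hij
    · have h1 := envelope_sub_le (k := k) ⟨x, hxS⟩ hwin hwS hwc
      have h2 : ∑ y, p y * v y - n ≤ ∑ y, p y * w y := by
        have h3 : ∑ y, p y * (v y - n) ≤ ∑ y, p y * w y :=
          Finset.sum_le_sum fun y _ => mul_le_mul_of_nonneg_left (by
            by_cases hy : y ∈ S
            · rw [hwin y hy]
            · rw [hwout y hy]; linarith) (hp.1 y)
        simpa only [mul_sub, Finset.sum_sub_distrib, ← Finset.sum_mul, hp.2, one_mul] using h3
      have h4 : envelope k v - ∑ y, p y * v y ≤ E u := hvE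
      show envelope k w - ∑ y, p y * w y ≤ E u
      linarith
  have hlt : ∑ y, w y < ∑ y, v y :=
    Finset.sum_lt_sum (fun y _ => hwv y) ⟨x, Finset.mem_univ _, by rw [hwin x hxS]; linarith⟩
  exact absurd (hmin hwK) (not_le.2 hlt)

/-- A uniform excess risk over all the score vectors having `T` as a top-`k` set. -/
lemma exists_excess_risk [NeZero n] {T : Finset (Fin n)} {p : Fin n → ℝ} (hp : p ∈ simplex n)
    (hT : ¬ Dominates T p) {r : ℝ}
    (hr : ∀ w : Fin n → ℝ, r ≤ envelope T.card w - ∑ y, p y * w y) :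
    ∃ ε > (0 : ℝ), ∀ u : Fin n → ℝ, Dominates T u →
      ε + r ≤ envelope T.card u - ∑ y, p y * u y := by
  simp only [Dominates, not_forall, not_le] at hT
  obtain ⟨i, hi, j, hj, hij⟩ := hT
  set E : (Fin n → ℝ) → ℝ := fun v => envelope T.card v - ∑ y, p y * v y with hE
  have hEc : Continuous E := (continuous_envelope T.card).sub (by fun_prop)
  set K : Set (Fin n → ℝ) :=
    Set.univ.pi (fun _ => Set.Icc (0 : ℝ) (n * (2 * n))) ∩ {v | Dominates T v} with hK
  have hKc : IsCompact K := (isCompact_univ_pi fun _ => isCompact_Icc).inter_right (isClosed_dominates T)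
  have hKne : K.Nonempty := ⟨0, fun _ _ => ⟨le_rfl, by simp only [Pi.zero_apply]; positivity⟩,
    fun _ _ _ _ => le_rfl⟩
  obtain ⟨v, ⟨-, hvT⟩, hmin⟩ := hKc.exists_isMinOn hKne hEc.continuousOn
  obtain ⟨w, hw⟩ := exists_risk_lt hvT hi hj hij
  refine ⟨E v - r, sub_pos.2 ((hr w).trans_lt hw), fun u hu => ?_⟩
  obtain ⟨v', hbox, hv'T, hv'⟩ := exists_bounded_risk_le T.card hp hu
  have : E v ≤ E v' := hmin ⟨fun x _ => hbox x, hv'T⟩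
  have h' : E v' ≤ E u := hv'
  change E v - r + r ≤ E u
  linarith

end TopKCalibration

theorem stmt2 (n k : ℕ) (hk : 1 ≤ k) (hkn : k < n)
    (ψ : (Fin n → ℝ) → Finset (Fin n))
    (hψ : ∀ u : Fin n → ℝ, (ψ u).card = k ∧ ∑ i ∈ ψ u, u i = sigmaTop n k u) :
    ∀ p ∈ simplex n, ∃ ε > (0 : ℝ), ∀ u : Fin n → ℝ,
      ¬ ((ψ u).card = k ∧ (∑ i ∈ ψ u, p i) = sigmaTop n k p) →
      ε + sInf (Set.range fun u' => ∑ y, p y * Lk n k u' y) ≤ ∑ y, p y * Lk n k u y := by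
  intro p hp
  have : NeZero n := ⟨by omega⟩
  simp only [sum_mul_Lk k hp]
  set r := sInf (Set.range fun u' : Fin n → ℝ => envelope k u' - ∑ y, p y * u' y) with hr
  have hrle : ∀ w : Fin n → ℝ, r ≤ envelope k w - ∑ y, p y * w y := fun w =>
    csInf_le ⟨0, by rintro _ ⟨u, rfl⟩; exact risk_nonneg k hp u⟩ ⟨w, rfl⟩
  have hex : ∀ T : Finset (Fin n), ∃ ε > (0 : ℝ), T.card = k → ¬ Dominates T p →
      ∀ u : Fin n → ℝ, Dominates T u → ε + r ≤ envelope k u - ∑ y, p y * u y := by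
    intro T
    by_cases h : T.card = k ∧ ¬ Dominates T p
    · obtain ⟨rfl, hT⟩ := h
      obtain ⟨ε, hε, hu⟩ := exists_excess_risk hp hT hrle
      exact ⟨ε, hε, fun _ _ => hu⟩
    · exact ⟨1, one_pos, fun h1 h2 => absurd ⟨h1, h2⟩ h⟩
  choose ε hε hεr using hex
  obtain ⟨T₀, -, hT₀⟩ := Finset.exists_min_image Finset.univ ε ⟨∅, Finset.mem_univ _⟩
  refine ⟨ε T₀, hε T₀, fun u hu => ?_⟩
  obtain ⟨hcard, hsum⟩ := hψ u
  have hnd : ¬ Dominates (ψ u) p := fun hd => hu ⟨hcard, by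
    have := hd.sum_eq (Finset.card_pos.1 (by omega))
    rwa [hcard] at this⟩
  have hdu : Dominates (ψ u) u := dominates_of_sum_eq (by rw [hcard]; exact hsum)
  have := hεr (ψ u) hcard hnd u hdu
  have := hT₀ (ψ u) (Finset.mem_univ _)
  linarith
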